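/- arXiv:2111.14397 — 7 statements merged into one kernel-verified Lean document; each statement's English description precedes it below -/
import Mathlib

section
/- Let μ be an orthogonally invariant probability measure on ℝⁿ and for z ∈ ℝ define F_z : ℝⁿ → [0,1] by F_z(x) = μ({w ∈ ℝⁿ : ⟨w, x⟩ ≥ z}). Then F_z(0) = 1 if z ≤ 0 and F_z(0) = 0 if z > 0, and for all x, y ∈ ℝⁿ with ‖x‖ ≤ ‖y‖: if z > 0 then F_z(x) ≤ F_z(y), while if z ≤ 0 then F_z(x) ≥ F_z(y). In other words, x ↦ F_z(x) is a monotone function of ‖x‖, nondecreasing for z > 0 and nonincreasing for z ≤ 0. (Monotonicity of the conditional tail probability in the norm of the previous layer's output.) -/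
open MeasureTheory ProbabilityTheory
open scoped RealInnerProductSpace

/-- The tail probability of an orthogonally invariant measure depends on `x` only through `‖x‖`. -/
theorem measure_le_inner_eq_of_norm_eq
    {E : Type*} [NormedAddCommGroup E] [InnerProductSpace ℝ E]
    [MeasurableSpace E] [BorelSpace E] {μ : Measure E}
    (hinv : ∀ Q : E ≃ₗᵢ[ℝ] E, Measure.map Q μ = μ) (z : ℝ) {x y : E} (h : ‖x‖ = ‖y‖) :
    μ {w | z ≤ ⟪w, x⟫} = μ {w | z ≤ ⟪w, y⟫} := by
  set Q : E ≃ₗᵢ[ℝ] E := (ℝ ∙ (x - y))ᗮ.reflection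
  have hQ : Q x = y := Submodule.reflection_sub h
  have hmeas : MeasurableSet {w : E | z ≤ ⟪w, y⟫} :=
    (isClosed_le continuous_const (by fun_prop)).measurableSet
  nth_rewrite 2 [← hinv Q]
  rw [Measure.map_apply Q.continuous.measurable hmeas]
  congr 1
  ext w
  simp only [Set.mem_preimage, Set.mem_ofPred_eq]
  rw [← hQ, Q.inner_map_map]

/-- Every `x` with `‖x‖ ≤ ‖y‖` has the same norm as a multiple `c • y` with `c ∈ [0, 1]`. -/
theorem exists_norm_eq_norm_smul_of_norm_le
    {E : Type*} [NormedAddCommGroup E] [NormedSpace ℝ E] {x y : E} (h : ‖x‖ ≤ ‖y‖) :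
    ∃ c : ℝ, 0 ≤ c ∧ c ≤ 1 ∧ ‖x‖ = ‖c • y‖ := by
  refine ⟨‖x‖ / ‖y‖, by positivity, div_le_one_of_le₀ h (norm_nonneg y), ?_⟩
  rw [norm_smul, Real.norm_of_nonneg (by positivity)]
  refine (div_mul_cancel_of_imp fun hy => ?_).symm
  exact le_antisymm (h.trans_eq hy) (norm_nonneg x)

/-- Monotonicity of the conditional tail probability `F_z(x) = μ {w : ⟨w, x⟩ ≥ z}` in the
norm of `x`, for an orthogonally invariant probability measure `μ` on `ℝⁿ`:
`F_z(0) = 1` for `z ≤ 0`, `F_z(0) = 0` for `z > 0`, and if `‖x‖ ≤ ‖y‖` then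
`F_z(x) ≤ F_z(y)` for `z > 0` while `F_z(y) ≤ F_z(x)` for `z ≤ 0`. -/
theorem tailProb_monotone_in_norm
    {n : ℕ} (μ : Measure (EuclideanSpace ℝ (Fin n))) [IsProbabilityMeasure μ]
    (hinv : ∀ Q : EuclideanSpace ℝ (Fin n) ≃ₗᵢ[ℝ] EuclideanSpace ℝ (Fin n),
      Measure.map Q μ = μ)
    (z : ℝ) :
    ((z ≤ 0 → μ {w | z ≤ ⟪w, (0 : EuclideanSpace ℝ (Fin n))⟫} = 1) ∧
      (0 < z → μ {w | z ≤ ⟪w, (0 : EuclideanSpace ℝ (Fin n))⟫} = 0)) ∧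
      ∀ x y : EuclideanSpace ℝ (Fin n), ‖x‖ ≤ ‖y‖ →
        (0 < z → μ {w | z ≤ ⟪w, x⟫} ≤ μ {w | z ≤ ⟪w, y⟫}) ∧
        (z ≤ 0 → μ {w | z ≤ ⟪w, y⟫} ≤ μ {w | z ≤ ⟪w, x⟫}) := by
  refine ⟨⟨fun hz => by simp [hz], fun hz => by simp [hz.not_ge]⟩, fun x y hxy => ?_⟩
  obtain ⟨c, hc0, hc1, hc⟩ := exists_norm_eq_norm_smul_of_norm_le hxy
  rw [measure_le_inner_eq_of_norm_eq hinv z hc]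
  simp only [real_inner_smul_right]
  refine ⟨fun hz => measure_mono fun w hw => ?_, fun hz => measure_mono fun w hw => ?_⟩ <;>
    simp only [Set.mem_ofPred_eq] at hw ⊢
  · have hpos : 0 < ⟪w, y⟫ := pos_of_mul_pos_right (hz.trans_le hw) hc0
    exact hw.trans (mul_le_of_le_one_left hpos.le hc1)
  · calc z ≤ c * z := by nlinarith
      _ ≤ c * ⟪w, y⟫ := mul_le_mul_of_nonneg_left hw hc0
end

section
/- Let μ be an orthogonally invariant probability measure on ℝⁿ and let W, W̃, X : Ω → ℝⁿ be mutually independent random vectors with W and W̃ both of law μ. Then for all z₁, z₂ ∈ ℝ with z₁ · z₂ > 0 (both positive or both negative), the hidden units are positively quadrant dependent at (z₁, z₂): Δ(z₁, z₂) ≥ 0, i.e. P(⟨W, X⟩ ≥ z₁, ⟨W̃, X⟩ ≥ z₂) ≥ P(⟨W, X⟩ ≥ z₁) · P(⟨W̃, X⟩ ≥ z₂). (Hidden units dependence theorem, positive-dependence part, for layers ℓ ≥ 2.) -/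
open MeasureTheory ProbabilityTheory
open scoped RealInnerProductSpace

open scoped ENNReal

/-- The rearrangement inequality for two pairs in `ℝ≥0∞`. -/
theorem ENNReal.mul_add_mul_le_of_le {a b c d : ℝ≥0∞} (hab : a ≤ b) (hcd : c ≤ d) :
    a * d + b * c ≤ a * c + b * d := by
  obtain ⟨e, rfl⟩ := exists_add_of_le hab
  obtain ⟨h, rfl⟩ := exists_add_of_le hcd
  calc a * (c + h) + (a + e) * c ≤ a * (c + h) + (a + e) * c + e * h := le_self_add
    _ = a * c + (a + e) * (c + h) := by ring

/-- **Chebyshev's integral inequality** for similarly ordered `ℝ≥0∞`-valued functions. -/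
theorem Monovary.lintegral_mul_lintegral_le {α : Type*} [MeasurableSpace α] {ν : Measure α}
    [IsProbabilityMeasure ν] {f g : α → ℝ≥0∞} (hfg : Monovary f g) (hf : Measurable f)
    (hg : Measurable g) :
    (∫⁻ x, f x ∂ν) * ∫⁻ x, g x ∂ν ≤ ∫⁻ x, f x * g x ∂ν := by
  have hpt (x y : α) : f x * g y + f y * g x ≤ f x * g x + f y * g y := by
    rcases lt_trichotomy (g x) (g y) with h | h | h
    · rw [add_comm (f x * g x)]
      simpa [add_comm] using ENNReal.mul_add_mul_le_of_le (hfg h) h.le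
    · rw [h]
    · simpa [add_comm] using ENNReal.mul_add_mul_le_of_le (hfg h) h.le
  have hint : (∫⁻ x, ∫⁻ y, f x * g y + f y * g x ∂ν ∂ν) ≤
      ∫⁻ x, ∫⁻ y, f x * g x + f y * g y ∂ν ∂ν :=
    lintegral_mono fun x => lintegral_mono fun y => hpt x y
  have hleft : (∫⁻ x, ∫⁻ y, f x * g y + f y * g x ∂ν ∂ν) =
      2 * ((∫⁻ x, f x ∂ν) * ∫⁻ x, g x ∂ν) := by
    have (x : α) : (∫⁻ y, f x * g y + f y * g x ∂ν) =
        f x * (∫⁻ y, g y ∂ν) + (∫⁻ y, f y ∂ν) * g x := by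
      rw [lintegral_add_left (hg.const_mul _), lintegral_const_mul _ hg,
        lintegral_mul_const _ hf]
    simp_rw [this]
    rw [lintegral_add_left (hf.mul_const _), lintegral_mul_const _ hf,
      lintegral_const_mul _ hg, two_mul]
  have hright : (∫⁻ x, ∫⁻ y, f x * g x + f y * g y ∂ν ∂ν) =
      2 * ∫⁻ x, f x * g x ∂ν := by
    have (x : α) : (∫⁻ y, f x * g x + f y * g y ∂ν) =
        f x * g x + ∫⁻ y, f y * g y ∂ν := by
      rw [lintegral_add_left measurable_const, lintegral_const, measure_univ, mul_one]
    simp_rw [this]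
    rw [lintegral_add_right _ measurable_const, lintegral_const, measure_univ, mul_one, two_mul]
  rw [hleft, hright] at hint
  exact (ENNReal.mul_le_mul_iff_right two_ne_zero ENNReal.ofNat_ne_top).mp hint

section Spherical

variable {E : Type*} [NormedAddCommGroup E] [InnerProductSpace ℝ E]

/-- A vector of norm at most `‖y‖` is a rotation of `c • y` for some `c ∈ [0, 1]`. -/
theorem exists_linearIsometryEquiv_eq_smul [CompleteSpace E] {x y : E} (h : ‖x‖ ≤ ‖y‖) :
    ∃ (Q : E ≃ₗᵢ[ℝ] E) (c : ℝ), 0 ≤ c ∧ c ≤ 1 ∧ Q (c • y) = x := by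
  have hnorm : ‖(‖x‖ / ‖y‖) • y‖ = ‖x‖ := by
    rcases eq_or_ne y 0 with rfl | hy
    · simp_all
    · rw [norm_smul, norm_div, norm_norm, norm_norm, div_mul_cancel₀ _ (norm_ne_zero_iff.mpr hy)]
  exact ⟨_, ‖x‖ / ‖y‖, by positivity, div_le_one_of_le₀ h (norm_nonneg _),
    Submodule.reflection_sub hnorm⟩

variable [MeasurableSpace E] [BorelSpace E]

theorem measure_le_inner_map (μ : Measure E) (hinv : ∀ Q : E ≃ₗᵢ[ℝ] E, Measure.map Q μ = μ)
    (Q : E ≃ₗᵢ[ℝ] E) (z : ℝ) (x : E) : μ {w | z ≤ ⟪w, Q x⟫} = μ {w | z ≤ ⟪w, x⟫} := by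
  have hs : MeasurableSet {w : E | z ≤ ⟪w, Q x⟫} :=
    (isClosed_le continuous_const (by fun_prop)).measurableSet
  conv_lhs => rw [← hinv Q, Measure.map_apply Q.continuous.measurable hs]
  simp

theorem measure_le_inner_mono_of_pos [CompleteSpace E] (μ : Measure E)
    (hinv : ∀ Q : E ≃ₗᵢ[ℝ] E, Measure.map Q μ = μ) {z : ℝ} (hz : 0 < z) {x y : E}
    (h : ‖x‖ ≤ ‖y‖) : μ {w | z ≤ ⟪w, x⟫} ≤ μ {w | z ≤ ⟪w, y⟫} := by
  obtain ⟨Q, c, hc0, hc1, rfl⟩ := exists_linearIsometryEquiv_eq_smul h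
  rw [measure_le_inner_map μ hinv]
  refine measure_mono fun w hw => ?_
  simp only [Set.mem_ofPred_eq, real_inner_smul_right] at hw ⊢
  exact hw.trans (mul_le_of_le_one_left (pos_of_mul_pos_right (hz.trans_le hw) hc0).le hc1)

theorem measure_le_inner_anti_of_neg [CompleteSpace E] (μ : Measure E)
    (hinv : ∀ Q : E ≃ₗᵢ[ℝ] E, Measure.map Q μ = μ) {z : ℝ} (hz : z < 0) {x y : E}
    (h : ‖x‖ ≤ ‖y‖) : μ {w | z ≤ ⟪w, y⟫} ≤ μ {w | z ≤ ⟪w, x⟫} := by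
  obtain ⟨Q, c, hc0, hc1, rfl⟩ := exists_linearIsometryEquiv_eq_smul h
  rw [measure_le_inner_map μ hinv]
  refine measure_mono fun w hw => ?_
  simp only [Set.mem_ofPred_eq, real_inner_smul_right] at hw ⊢
  nlinarith [mul_le_mul_of_nonneg_left hw hc0]

theorem monovary_measure_le_inner [CompleteSpace E] (μ : Measure E)
    (hinv : ∀ Q : E ≃ₗᵢ[ℝ] E, Measure.map Q μ = μ) {z₁ z₂ : ℝ} (hz : 0 < z₁ * z₂) :
    Monovary (fun x => μ {w | z₁ ≤ ⟪w, x⟫}) (fun x => μ {w | z₂ ≤ ⟪w, x⟫}) := by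
  intro x y hxy
  rcases pos_and_pos_or_neg_and_neg_of_mul_pos hz with ⟨h₁, h₂⟩ | ⟨h₁, h₂⟩
  · refine measure_le_inner_mono_of_pos μ hinv h₁ (le_of_not_ge fun h => ?_)
    exact hxy.not_ge (measure_le_inner_mono_of_pos μ hinv h₂ h)
  · refine measure_le_inner_anti_of_neg μ hinv h₁ (le_of_not_ge fun h => ?_)
    exact hxy.not_ge (measure_le_inner_anti_of_neg μ hinv h₂ h)

end Spherical

/-- The probability that an independent pair lies in `s`, as an integral over the second
component. -/
theorem ProbabilityTheory.IndepFun.measure_mem_eq_lintegral {Ω α β : Type*} [MeasurableSpace Ω]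
    [MeasurableSpace α] [MeasurableSpace β] {P : Measure Ω} [IsProbabilityMeasure P]
    {U : Ω → α} {V : Ω → β} (hUV : IndepFun U V P) (hU : Measurable U) (hV : Measurable V)
    {s : Set (α × β)} (hs : MeasurableSet s) :
    P {ω | (U ω, V ω) ∈ s} = ∫⁻ v, P.map U {u | (u, v) ∈ s} ∂(P.map V) := by
  have := Measure.isProbabilityMeasure_map (μ := P) hU.aemeasurable
  have := Measure.isProbabilityMeasure_map (μ := P) hV.aemeasurable
  have hmap := (indepFun_iff_map_prod_eq_prod_map_map hU.aemeasurable hV.aemeasurable).mp hUV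
  calc P {ω | (U ω, V ω) ∈ s} = P.map (fun ω => (U ω, V ω)) s :=
        (Measure.map_apply (hU.prodMk hV) hs).symm
    _ = _ := by rw [hmap, Measure.prod_apply_symm hs]; rfl

/-- Hidden units dependence theorem, positive-dependence part (layers `ℓ ≥ 2`): for an
orthogonally invariant weight prior `μ` and mutually independent `W, W̃, X` with `W, W̃` of
law `μ`, if `z₁ z₂ > 0` then the hidden units are positively quadrant dependent:
`P(⟨W, X⟩ ≥ z₁) · P(⟨W̃, X⟩ ≥ z₂) ≤ P(⟨W, X⟩ ≥ z₁, ⟨W̃, X⟩ ≥ z₂)`. -/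
theorem hidden_units_positively_quadrant_dependent
    {Ω : Type*} [MeasureSpace Ω] [IsProbabilityMeasure (ℙ : Measure Ω)]
    {n : ℕ} (μ : Measure (EuclideanSpace ℝ (Fin n))) [IsProbabilityMeasure μ]
    (hinv : ∀ Q : EuclideanSpace ℝ (Fin n) ≃ₗᵢ[ℝ] EuclideanSpace ℝ (Fin n),
      Measure.map Q μ = μ)
    (W W' X : Ω → EuclideanSpace ℝ (Fin n))
    (hWmeas : Measurable W) (hW'meas : Measurable W') (hXmeas : Measurable X)
    (hindep : IndepFun W W' ℙ)
    (hindepX : IndepFun (fun ω => (W ω, W' ω)) X ℙ)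
    (hWlaw : Measure.map W ℙ = μ) (hW'law : Measure.map W' ℙ = μ)
    (z₁ z₂ : ℝ) (hz : 0 < z₁ * z₂) :
    ℙ {ω | z₁ ≤ ⟪W ω, X ω⟫} * ℙ {ω | z₂ ≤ ⟪W' ω, X ω⟫} ≤
      ℙ {ω | z₁ ≤ ⟪W ω, X ω⟫ ∧ z₂ ≤ ⟪W' ω, X ω⟫} := by
  have hs (z : ℝ) : MeasurableSet {p : EuclideanSpace ℝ (Fin n) × EuclideanSpace ℝ (Fin n) |
      z ≤ ⟪p.1, p.2⟫} :=
    (isClosed_le continuous_const (by fun_prop)).measurableSet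
  have hst : MeasurableSet {p : (EuclideanSpace ℝ (Fin n) × EuclideanSpace ℝ (Fin n)) ×
      EuclideanSpace ℝ (Fin n) | z₁ ≤ ⟪p.1.1, p.2⟫ ∧ z₂ ≤ ⟪p.1.2, p.2⟫} := by
    rw [Set.ofPred_and]
    exact (measurableSet_le measurable_const (by fun_prop)).inter
      (measurableSet_le measurable_const (by fun_prop))
  have hF (z : ℝ) : Measurable fun x => μ {w | z ≤ ⟪w, x⟫} :=
    measurable_measure_prodMk_right (hs z)
  have hWX : IndepFun W X ℙ := hindepX.comp measurable_fst measurable_id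
  have hW'X : IndepFun W' X ℙ := hindepX.comp measurable_snd measurable_id
  have hpair : Measure.map (fun ω => (W ω, W' ω)) ℙ = μ.prod μ := by
    rw [(indepFun_iff_map_prod_eq_prod_map_map hWmeas.aemeasurable hW'meas.aemeasurable).mp
      hindep, hWlaw, hW'law]
  have e₁ := hWX.measure_mem_eq_lintegral hWmeas hXmeas (hs z₁)
  have e₂ := hW'X.measure_mem_eq_lintegral hW'meas hXmeas (hs z₂)
  have e := hindepX.measure_mem_eq_lintegral (hWmeas.prodMk hW'meas) hXmeas hst
  simp only [Set.mem_ofPred_eq, hWlaw, hW'law, hpair] at e₁ e₂ e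
  have hprod (x : EuclideanSpace ℝ (Fin n)) :
      μ.prod μ {p | z₁ ≤ ⟪p.1, x⟫ ∧ z₂ ≤ ⟪p.2, x⟫} =
        μ {w | z₁ ≤ ⟪w, x⟫} * μ {w | z₂ ≤ ⟪w, x⟫} := by
    rw [← Measure.prod_prod]
    rfl
  rw [e₁, e₂, e]
  simp_rw [hprod]
  have := Measure.isProbabilityMeasure_map (μ := ℙ) hXmeas.aemeasurable
  exact (monovary_measure_le_inner μ hinv hz).lintegral_mul_lintegral_le (hF z₁) (hF z₂)
end

section
/- Let μ be an orthogonally invariant probability measure on ℝⁿ and let W, W̃, X : Ω → ℝⁿ be mutually independent random vectors with W and W̃ both of law μ. Then for all z₁, z₂ ∈ ℝ with z₁ · z₂ < 0 (opposite signs), the hidden units are negatively quadrant dependent at (z₁, z₂): Δ(z₁, z₂) ≤ 0, i.e. P(⟨W, X⟩ ≥ z₁, ⟨W̃, X⟩ ≥ z₂) ≤ P(⟨W, X⟩ ≥ z₁) · P(⟨W̃, X⟩ ≥ z₂). (Hidden units dependence theorem, negative-dependence part, for layers ℓ ≥ 2.) -/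
open MeasureTheory ProbabilityTheory
open scoped RealInnerProductSpace

section NegativeQuadrantDependence

variable {E : Type*} [NormedAddCommGroup E] [InnerProductSpace ℝ E] [MeasurableSpace E]

/-- **Chebyshev's integral inequality** for antivarying functions on a probability space. -/
theorem lintegral_mul_le_of_antivary {α : Type*} [MeasurableSpace α] {ν : Measure α}
    [IsProbabilityMeasure ν] {f g : α → ENNReal} (hf : Measurable f) (hg : Measurable g)
    (hfg : Antivary f g) :
    ∫⁻ x, f x * g x ∂ν ≤ (∫⁻ x, f x ∂ν) * ∫⁻ x, g x ∂ν := by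
  have rearrange {a b c d : ENNReal} (hab : a ≤ b) (hcd : c ≤ d) :
      a * d + b * c ≤ a * c + b * d := by
    obtain ⟨e, rfl⟩ := exists_add_of_le hab
    obtain ⟨k, rfl⟩ := exists_add_of_le hcd
    calc a * (c + k) + (a + e) * c ≤ a * (c + k) + (a + e) * c + e * k := le_self_add
      _ = a * c + (a + e) * (c + k) := by ring
  have pointwise (x y : α) : f x * g x + f y * g y ≤ f x * g y + f y * g x := by
    rcases lt_trichotomy (g x) (g y) with h | h | h
    · simpa only [add_comm] using rearrange (hfg h) h.le
    · rw [h]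
    · exact rearrange (hfg h) h.le
  have hsum : ∫⁻ x, ∫⁻ y, (f x * g x + f y * g y) ∂ν ∂ν ≤
      ∫⁻ x, ∫⁻ y, (f x * g y + f y * g x) ∂ν ∂ν :=
    lintegral_mono fun x => lintegral_mono fun y => pointwise x y
  have hleft (x : α) : ∫⁻ y, (f x * g x + f y * g y) ∂ν = f x * g x + ∫⁻ y, f y * g y ∂ν := by
    rw [lintegral_add_left measurable_const, lintegral_const, measure_univ, mul_one]
  have hright (x : α) : ∫⁻ y, (f x * g y + f y * g x) ∂ν =
      f x * ∫⁻ y, g y ∂ν + (∫⁻ y, f y ∂ν) * g x := by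
    rw [lintegral_add_left (hg.const_mul _), lintegral_const_mul _ hg, lintegral_mul_const _ hf]
  simp only [hleft, hright] at hsum
  rw [lintegral_add_right _ measurable_const, lintegral_add_left (hf.mul_const _),
    lintegral_mul_const _ hf, lintegral_const_mul _ hg, lintegral_const, measure_univ, mul_one,
    ← two_mul, ← two_mul] at hsum
  exact (ENNReal.mul_le_mul_iff_right two_ne_zero ENNReal.ofNat_ne_top).1 hsum

/-- Under an orthogonally invariant measure, the measure of a half-space depends on its normal
vector only through the norm. -/
theorem measure_halfSpace_eq_of_norm_eq [BorelSpace E] {μ : Measure E}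
    (hinv : ∀ Q : E ≃ₗᵢ[ℝ] E, Measure.map Q μ = μ) {x y : E} (h : ‖x‖ = ‖y‖) (z : ℝ) :
    μ {w | z ≤ ⟪w, x⟫} = μ {w | z ≤ ⟪w, y⟫} := by
  set Q : E ≃ₗᵢ[ℝ] E := (Submodule.span ℝ {x - y})ᗮ.reflection
  have hQx : Q x = y := Submodule.reflection_sub h
  have hmeas : MeasurableSet {w : E | z ≤ ⟪w, y⟫} :=
    (isClosed_le continuous_const (by fun_prop)).measurableSet
  conv_rhs => rw [← hinv Q, Measure.map_apply Q.continuous.measurable hmeas]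
  congr 1
  ext w
  simp [← hQx]

theorem measure_halfSpace_eq_smul [BorelSpace E] {μ : Measure E}
    (hinv : ∀ Q : E ≃ₗᵢ[ℝ] E, Measure.map Q μ = μ) {x y : E} (h : ‖x‖ ≤ ‖y‖) :
    ∃ c : ℝ, 0 ≤ c ∧ c ≤ 1 ∧
      ∀ z : ℝ, μ {w | z ≤ ⟪w, x⟫} = μ {w | z ≤ c * ⟪w, y⟫} := by
  refine ⟨‖x‖ / ‖y‖, by positivity, div_le_one_of_le₀ h (norm_nonneg _), fun z => ?_⟩
  have hnorm : ‖x‖ = ‖(‖x‖ / ‖y‖) • y‖ := by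
    rw [norm_smul, Real.norm_of_nonneg (by positivity)]
    by_cases hy : ‖y‖ = 0
    · have := norm_nonneg x
      rw [hy] at h ⊢
      simpa using le_antisymm h this
    · field_simp
  rw [measure_halfSpace_eq_of_norm_eq hinv hnorm]
  simp only [inner_smul_right]

/-- A half-space at positive distance from the origin gains mass as its normal vector grows. -/
theorem measure_halfSpace_le_of_pos [BorelSpace E] {μ : Measure E}
    (hinv : ∀ Q : E ≃ₗᵢ[ℝ] E, Measure.map Q μ = μ) {z : ℝ} (hz : 0 < z) {x y : E}
    (h : ‖x‖ ≤ ‖y‖) : μ {w | z ≤ ⟪w, x⟫} ≤ μ {w | z ≤ ⟪w, y⟫} := by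
  obtain ⟨c, hc0, hc1, hc⟩ := measure_halfSpace_eq_smul hinv h
  rw [hc]
  refine measure_mono fun w (hw : z ≤ c * ⟪w, y⟫) => ?_
  have hpos : 0 < ⟪w, y⟫ := pos_of_mul_pos_right (hz.trans_le hw) hc0
  exact hw.trans (mul_le_of_le_one_left hpos.le hc1)

/-- A half-space containing the origin in its interior loses mass as its normal vector grows. -/
theorem measure_halfSpace_le_of_neg [BorelSpace E] {μ : Measure E}
    (hinv : ∀ Q : E ≃ₗᵢ[ℝ] E, Measure.map Q μ = μ) {z : ℝ} (hz : z < 0) {x y : E}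
    (h : ‖x‖ ≤ ‖y‖) : μ {w | z ≤ ⟪w, y⟫} ≤ μ {w | z ≤ ⟪w, x⟫} := by
  obtain ⟨c, hc0, hc1, hc⟩ := measure_halfSpace_eq_smul hinv h
  rw [hc]
  refine measure_mono fun w (hw : z ≤ ⟪w, y⟫) => ?_
  show z ≤ c * ⟪w, y⟫
  rcases le_total 0 ⟪w, y⟫ with hs | hs
  · exact hz.le.trans (mul_nonneg hc0 hs)
  · nlinarith

theorem antivary_measure_halfSpace [BorelSpace E] {μ : Measure E}
    (hinv : ∀ Q : E ≃ₗᵢ[ℝ] E, Measure.map Q μ = μ) {z₁ z₂ : ℝ} (hz : z₁ * z₂ < 0) :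
    Antivary (fun x : E => μ {w | z₁ ≤ ⟪w, x⟫}) (fun x : E => μ {w | z₂ ≤ ⟪w, x⟫}) := by
  intro x y hxy
  rcases mul_neg_iff.1 hz with ⟨h₁, h₂⟩ | ⟨h₁, h₂⟩
  · refine measure_halfSpace_le_of_pos hinv h₁ ?_
    contrapose! hxy
    exact measure_halfSpace_le_of_neg hinv h₂ hxy.le
  · refine measure_halfSpace_le_of_neg hinv h₁ ?_
    contrapose! hxy
    exact measure_halfSpace_le_of_pos hinv h₂ hxy.le

end NegativeQuadrantDependence

/-- The probability of an event about a pair of independent variables, computed by conditioning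
on the second one. -/
theorem measure_setOf_prodMk_eq_lintegral {Ω α β : Type*} [MeasurableSpace Ω] [MeasurableSpace α]
    [MeasurableSpace β] {P : Measure Ω} [IsProbabilityMeasure P] {V : Ω → α} {X : Ω → β}
    (hV : Measurable V) (hX : Measurable X) (h : IndepFun V X P) {S : Set (α × β)}
    (hS : MeasurableSet S) :
    P {ω | (V ω, X ω) ∈ S} = ∫⁻ x, P.map V {v | (v, x) ∈ S} ∂P.map X := by
  have := Measure.isProbabilityMeasure_map (μ := P) hV.aemeasurable
  have := Measure.isProbabilityMeasure_map (μ := P) hX.aemeasurable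
  have hmap := (indepFun_iff_map_prod_eq_prod_map_map hV.aemeasurable hX.aemeasurable).1 h
  calc P {ω | (V ω, X ω) ∈ S} = P.map (fun ω => (V ω, X ω)) S :=
        (Measure.map_apply (hV.prodMk hX) hS).symm
    _ = _ := by rw [hmap, Measure.prod_apply_symm hS]; rfl

/-- Hidden units dependence theorem, negative-dependence part (layers `ℓ ≥ 2`): for an
orthogonally invariant weight prior `μ` and mutually independent `W, W̃, X` with `W, W̃` of
law `μ`, if `z₁ z₂ < 0` then the hidden units are negatively quadrant dependent:
`P(⟨W, X⟩ ≥ z₁, ⟨W̃, X⟩ ≥ z₂) ≤ P(⟨W, X⟩ ≥ z₁) · P(⟨W̃, X⟩ ≥ z₂)`. -/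
theorem hidden_units_negatively_quadrant_dependent
    {Ω : Type*} [MeasureSpace Ω] [IsProbabilityMeasure (ℙ : Measure Ω)]
    {n : ℕ} (μ : Measure (EuclideanSpace ℝ (Fin n))) [IsProbabilityMeasure μ]
    (hinv : ∀ Q : EuclideanSpace ℝ (Fin n) ≃ₗᵢ[ℝ] EuclideanSpace ℝ (Fin n),
      Measure.map Q μ = μ)
    (W W' X : Ω → EuclideanSpace ℝ (Fin n))
    (hWmeas : Measurable W) (hW'meas : Measurable W') (hXmeas : Measurable X)
    (hindep : IndepFun W W' ℙ)
    (hindepX : IndepFun (fun ω => (W ω, W' ω)) X ℙ)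
    (hWlaw : Measure.map W ℙ = μ) (hW'law : Measure.map W' ℙ = μ)
    (z₁ z₂ : ℝ) (hz : z₁ * z₂ < 0) :
    ℙ {ω | z₁ ≤ ⟪W ω, X ω⟫ ∧ z₂ ≤ ⟪W' ω, X ω⟫} ≤
      ℙ {ω | z₁ ≤ ⟪W ω, X ω⟫} * ℙ {ω | z₂ ≤ ⟪W' ω, X ω⟫} := by
  have : IsProbabilityMeasure (Measure.map X ℙ) :=
    Measure.isProbabilityMeasure_map hXmeas.aemeasurable
  have hS (z : ℝ) : MeasurableSet {p : EuclideanSpace ℝ (Fin n) × EuclideanSpace ℝ (Fin n) |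
      z ≤ ⟪p.1, p.2⟫} := (isClosed_le continuous_const (by fun_prop)).measurableSet
  have hmeas (z : ℝ) : Measurable fun x : EuclideanSpace ℝ (Fin n) => μ {w | z ≤ ⟪w, x⟫} :=
    measurable_measure_prodMk_right (hS z)
  have hW : ℙ {ω | z₁ ≤ ⟪W ω, X ω⟫} = ∫⁻ x, μ {w | z₁ ≤ ⟪w, x⟫} ∂Measure.map X ℙ := by
    rw [← hWlaw]
    exact measure_setOf_prodMk_eq_lintegral hWmeas hXmeas
      (hindepX.comp measurable_fst measurable_id) (hS z₁)
  have hW' : ℙ {ω | z₂ ≤ ⟪W' ω, X ω⟫} = ∫⁻ x, μ {w | z₂ ≤ ⟪w, x⟫} ∂Measure.map X ℙ := by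
    rw [← hW'law]
    exact measure_setOf_prodMk_eq_lintegral hW'meas hXmeas
      (hindepX.comp measurable_snd measurable_id) (hS z₂)
  have hpair : Measure.map (fun ω => (W ω, W' ω)) ℙ = μ.prod μ := by
    rw [(indepFun_iff_map_prod_eq_prod_map_map hWmeas.aemeasurable hW'meas.aemeasurable).1 hindep,
      hWlaw, hW'law]
  have hjoint : ℙ {ω | z₁ ≤ ⟪W ω, X ω⟫ ∧ z₂ ≤ ⟪W' ω, X ω⟫} =
      ∫⁻ x, μ {w | z₁ ≤ ⟪w, x⟫} * μ {w | z₂ ≤ ⟪w, x⟫} ∂Measure.map X ℙ := by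
    have hT : MeasurableSet {p : (EuclideanSpace ℝ (Fin n) × EuclideanSpace ℝ (Fin n)) ×
        EuclideanSpace ℝ (Fin n) | z₁ ≤ ⟪p.1.1, p.2⟫ ∧ z₂ ≤ ⟪p.1.2, p.2⟫} :=
      ((hS z₁).preimage (measurable_fst.fst.prodMk measurable_snd)).inter
        ((hS z₂).preimage (measurable_fst.snd.prodMk measurable_snd))
    refine (measure_setOf_prodMk_eq_lintegral (hWmeas.prodMk hW'meas) hXmeas hindepX hT).trans ?_
    rw [hpair]
    exact lintegral_congr fun x => Measure.prod_prod {w | z₁ ≤ ⟪w, x⟫} {w | z₂ ≤ ⟪w, x⟫}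
  rw [hW, hW', hjoint]
  exact lintegral_mul_le_of_antivary (hmeas z₁) (hmeas z₂) (antivary_measure_halfSpace hinv hz)
end

section
/- Let W, W̃, X : Ω → ℝⁿ be mutually independent random vectors with W and W̃ both of law μ, where μ satisfies μ({w : ⟨w, x⟩ ≥ 0}) = 1/2 for every x ≠ 0 (as holds for a centered elliptical prior with a density). Set p = P(X = 0) and F_z(x) = μ({w : ⟨w, x⟩ ≥ z}). Then for every z ∈ ℝ: Δ(0, z) = (p/2) · ( (1 − p) · 𝟙[z ≤ 0] − E[ 𝟙{X ≠ 0} · F_z(X) ] ). (Exact formula for the dependence measure at threshold zero in terms of the probability p that the previous layer's output vanishes.) -/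
open MeasureTheory ProbabilityTheory
open scoped RealInnerProductSpace Classical

/-- The probability that an independent pair lies in `S` is the expectation of the measure of
the random section of `S`. -/
theorem toReal_measure_pair_mem_eq_integral {Ω α β : Type*} [MeasurableSpace Ω]
    [MeasurableSpace α] [MeasurableSpace β] {P : Measure Ω} [IsProbabilityMeasure P]
    {Y : Ω → α} {X : Ω → β} (hY : Measurable Y) (hX : Measurable X) (h : IndepFun Y X P)
    {S : Set (α × β)} (hS : MeasurableSet S) :
    (P {ω | (Y ω, X ω) ∈ S}).toReal = ∫ ω, (P.map Y {y | (y, X ω) ∈ S}).toReal ∂P := by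
  have : IsProbabilityMeasure (P.map Y) := Measure.isProbabilityMeasure_map hY.aemeasurable
  have : IsProbabilityMeasure (P.map X) := Measure.isProbabilityMeasure_map hX.aemeasurable
  have hsection : Measurable fun x => P.map Y {y | (y, x) ∈ S} :=
    measurable_measure_prodMk_right hS
  rw [integral_toReal (f := fun ω => P.map Y {y | (y, X ω) ∈ S})
    (hsection.comp hX).aemeasurable (ae_of_all _ fun _ => measure_lt_top _ _)]
  congr 1
  calc P {ω | (Y ω, X ω) ∈ S} = P.map (fun ω => (Y ω, X ω)) S :=
        (Measure.map_apply (hY.prodMk hX) hS).symm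
    _ = ∫⁻ x, P.map Y {y | (y, x) ∈ S} ∂(P.map X) := by
        rw [(indepFun_iff_map_prod_eq_prod_map_map hY.aemeasurable hX.aemeasurable).1 h,
          Measure.prod_apply_symm hS]
        rfl
    _ = ∫⁻ ω, P.map Y {y | (y, X ω) ∈ S} ∂P := lintegral_map hsection hX

theorem integral_ite_const_eq_add {Ω : Type*} [MeasurableSpace Ω] {P : Measure Ω}
    [IsFiniteMeasure P] {q : Ω → Prop} [DecidablePred q] (hq : MeasurableSet {ω | q ω}) (c : ℝ)
    {f : Ω → ℝ} (hf : Integrable f P) :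
    ∫ ω, (if q ω then c else f ω) ∂P =
      (P {ω | q ω}).toReal * c + ∫ ω, (if ¬ q ω then f ω else 0) ∂P := by
  have hsum : (fun ω => if q ω then c else f ω) =
      fun ω => {ω | q ω}.indicator (fun _ => c) ω + {ω | q ω}ᶜ.indicator f ω := by
    ext ω
    by_cases hω : q ω <;> simp [hω]
  have hcompl : (fun ω => if ¬ q ω then f ω else 0) = {ω | q ω}ᶜ.indicator f := by
    ext ω
    by_cases hω : q ω <;> simp [hω]
  rw [hsum, hcompl, integral_add ((integrable_const c).indicator hq) (hf.indicator hq.compl),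
    integral_indicator_const c hq]
  rfl

/-- Exact formula for the dependence measure at threshold zero: with `p = P(X = 0)`,
`F_z(x) = μ {w : ⟨w, x⟩ ≥ z}`, and a weight prior giving mass `1/2` to every half-space
through the origin, `Δ(0, z) = (p/2) ((1 − p) 𝟙[z ≤ 0] − E[𝟙{X ≠ 0} F_z(X)])`. -/
theorem delta_zero_z_formula
    {Ω : Type*} [MeasureSpace Ω] [IsProbabilityMeasure (ℙ : Measure Ω)]
    {n : ℕ} (μ : Measure (EuclideanSpace ℝ (Fin n))) [IsProbabilityMeasure μ]
    (hhalf : ∀ x : EuclideanSpace ℝ (Fin n), x ≠ 0 → μ {w | 0 ≤ ⟪w, x⟫} = 1 / 2)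
    (W W' X : Ω → EuclideanSpace ℝ (Fin n))
    (hWmeas : Measurable W) (hW'meas : Measurable W') (hXmeas : Measurable X)
    (hindep : IndepFun W W' ℙ)
    (hindepX : IndepFun (fun ω => (W ω, W' ω)) X ℙ)
    (hWlaw : Measure.map W ℙ = μ) (hW'law : Measure.map W' ℙ = μ)
    (z : ℝ) :
    (ℙ {ω | 0 ≤ ⟪W ω, X ω⟫ ∧ z ≤ ⟪W' ω, X ω⟫}).toReal -
        (ℙ {ω | 0 ≤ ⟪W ω, X ω⟫}).toReal * (ℙ {ω | z ≤ ⟪W' ω, X ω⟫}).toReal =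
      (ℙ {ω | X ω = 0}).toReal / 2 *
        ((1 - (ℙ {ω | X ω = 0}).toReal) * (if z ≤ 0 then (1 : ℝ) else 0) -
          ∫ ω, if X ω ≠ 0 then (μ {w | z ≤ ⟪w, X ω⟫}).toReal else 0) := by
  set F : EuclideanSpace ℝ (Fin n) → ℝ := fun x => (μ {w | z ≤ ⟪w, x⟫}).toReal with hF
  set p := (ℙ {ω | X ω = 0}).toReal with hp
  set I : ℝ := if z ≤ 0 then (1 : ℝ) else 0 with hI
  have hset (a : ℝ) : MeasurableSet {q : EuclideanSpace ℝ (Fin n) × EuclideanSpace ℝ (Fin n) |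
      a ≤ ⟪q.1, q.2⟫} :=
    measurableSet_le measurable_const (by fun_prop)
  have hX0 : MeasurableSet {ω | X ω = 0} := hXmeas (measurableSet_singleton 0)
  have hF0 : F 0 = I := by
    by_cases h : z ≤ 0 <;> simp [hF, hI, h]
  have hF_integrable : Integrable (fun ω => F (X ω)) ℙ := by
    refine Integrable.of_bound (C := 1) ?_ (ae_of_all _ fun ω => ?_)
    · exact (((measurable_measure_prodMk_right (μ := μ) (hset z)).comp
        hXmeas).ennreal_toReal).aestronglyMeasurable
    · rw [Real.norm_of_nonneg ENNReal.toReal_nonneg]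
      exact measureReal_le_one
  have hWX : IndepFun W X ℙ := hindepX.comp measurable_fst measurable_id
  have hW'X : IndepFun W' X ℙ := hindepX.comp measurable_snd measurable_id
  have hsecond : (ℙ {ω | z ≤ ⟪W' ω, X ω⟫}).toReal =
      p * I + ∫ ω, if X ω ≠ 0 then F (X ω) else 0 := by
    have h := toReal_measure_pair_mem_eq_integral hW'meas hXmeas hW'X (hset z)
    rw [hW'law] at h
    refine h.trans (Eq.trans ?_
      (integral_ite_const_eq_add (q := fun ω => X ω = 0) hX0 I hF_integrable))
    refine integral_congr_ae (ae_of_all _ fun ω => ?_)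
    by_cases hω : X ω = 0
    · simpa [hω, hF] using hF0
    · simp [hω, hF]
  have hfirst : (ℙ {ω | 0 ≤ ⟪W ω, X ω⟫}).toReal = (1 + p) / 2 := by
    have h := toReal_measure_pair_mem_eq_integral hWmeas hXmeas hWX (hset 0)
    rw [hWlaw] at h
    have hsplit : ∀ ω, (μ {w | 0 ≤ ⟪w, X ω⟫}).toReal =
        1 / 2 + {ω | X ω = 0}.indicator (fun _ => (1 / 2 : ℝ)) ω := by
      intro ω
      by_cases hω : X ω = 0
      · simp [hω]
        norm_num
      · simp [hω, hhalf _ hω]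
    refine h.trans ((integral_congr_ae (ae_of_all _ hsplit)).trans ?_)
    rw [integral_add (integrable_const _) ((integrable_const _).indicator hX0),
      integral_indicator_const _ hX0]
    simp only [integral_const, probReal_univ, smul_eq_mul,
      measureReal_def (s := {ω | X ω = 0}), ← hp]
    ring
  have hjoint : (ℙ {ω | 0 ≤ ⟪W ω, X ω⟫ ∧ z ≤ ⟪W' ω, X ω⟫}).toReal =
      p * I + (∫ ω, if X ω ≠ 0 then F (X ω) else 0) / 2 := by
    have hlaw : Measure.map (fun ω => (W ω, W' ω)) ℙ = μ.prod μ := by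
      rw [(indepFun_iff_map_prod_eq_prod_map_map hWmeas.aemeasurable
        hW'meas.aemeasurable).1 hindep, hWlaw, hW'law]
    have hS : MeasurableSet {q : (EuclideanSpace ℝ (Fin n) × EuclideanSpace ℝ (Fin n)) ×
        EuclideanSpace ℝ (Fin n) | 0 ≤ ⟪q.1.1, q.2⟫ ∧ z ≤ ⟪q.1.2, q.2⟫} := by
      rw [Set.ofPred_and]
      exact (measurableSet_le measurable_const (by fun_prop)).inter
        (measurableSet_le measurable_const (by fun_prop))
    have h := toReal_measure_pair_mem_eq_integral (hWmeas.prodMk hW'meas) hXmeas hindepX hS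
    rw [hlaw] at h
    have hhalf_sum : (∫ ω, if X ω ≠ 0 then F (X ω) else 0) / 2 =
        ∫ ω, if ¬ X ω = 0 then F (X ω) / 2 else 0 := by
      rw [← integral_div]
      refine integral_congr_ae (ae_of_all _ fun ω => ?_)
      by_cases hω : X ω = 0 <;> simp [hω]
    rw [hhalf_sum]
    refine h.trans (Eq.trans ?_
      (integral_ite_const_eq_add (q := fun ω => X ω = 0) hX0 I (hF_integrable.div_const 2)))
    refine integral_congr_ae (ae_of_all _ fun ω => ?_)
    have hprod : (μ.prod μ {y | (y, X ω) ∈ {q : (EuclideanSpace ℝ (Fin n) ×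
        EuclideanSpace ℝ (Fin n)) × EuclideanSpace ℝ (Fin n) |
          0 ≤ ⟪q.1.1, q.2⟫ ∧ z ≤ ⟪q.1.2, q.2⟫}}).toReal =
        (μ {w | 0 ≤ ⟪w, X ω⟫}).toReal * F (X ω) := by
      rw [hF, ← ENNReal.toReal_mul, ← Measure.prod_prod]
      rfl
    refine hprod.trans ?_
    by_cases hω : X ω = 0
    · simp [hω, hF0]
    · simp [hω, hhalf _ hω]
      ring
  rw [hjoint, hfirst, hsecond]
  ring
end

section
/- Let W, W̃, X : Ω → ℝⁿ be mutually independent random vectors with W and W̃ both of law μ, where μ satisfies μ({w : ⟨w, x⟩ ≥ 0}) = 1/2 for every x ≠ 0 (as holds for a centered elliptical prior with a density). Set p = P(X = 0). Then Δ(0, 0) = p(1 − p)/4; in particular Δ(0, 0) ≥ 0, with equality if and only if p = 0 or p = 1. -/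
open MeasureTheory ProbabilityTheory
open scoped RealInnerProductSpace

/-- Total probability for an independent pair `(Z, X)`: if the section of `A` at `x₀` has full mass
under the law of `Z` and every other section has mass `c`, then `P((Z, X) ∈ A) = p + c(1 − p)`,
where `p = P(X = x₀)`. -/
theorem ProbabilityTheory.IndepFun.measure_eq_add_mul_of_sections
    {Ω E F : Type*} [MeasurableSpace Ω] [MeasurableSpace E] [MeasurableSpace F]
    [MeasurableSingletonClass F] {P : Measure Ω} [IsProbabilityMeasure P]
    {Z : Ω → E} {X : Ω → F} (hZ : Measurable Z) (hX : Measurable X) (hind : IndepFun Z X P)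
    {A : Set (E × F)} (hA : MeasurableSet A) (x₀ : F) (c : ENNReal)
    (hx₀ : P.map Z ((fun z => (z, x₀)) ⁻¹' A) = 1)
    (hc : ∀ x, x ≠ x₀ → P.map Z ((fun z => (z, x)) ⁻¹' A) = c) :
    P ((fun ω => (Z ω, X ω)) ⁻¹' A) = P {ω | X ω = x₀} + c * (1 - P {ω | X ω = x₀}) := by
  have := Measure.isProbabilityMeasure_map (μ := P) hZ.aemeasurable
  have := Measure.isProbabilityMeasure_map (μ := P) hX.aemeasurable
  have hs : MeasurableSet ({x₀} : Set F) := measurableSet_singleton x₀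
  have hp : P.map X {x₀} = P {ω | X ω = x₀} := Measure.map_apply hX hs
  rw [← Measure.map_apply (hZ.prodMk hX) hA,
    (indepFun_iff_map_prod_eq_prod_map_map hZ.aemeasurable hX.aemeasurable).1 hind,
    Measure.prod_apply_symm hA, ← lintegral_add_compl _ hs, ← hp,
    ← prob_compl_eq_one_sub hs]
  congr 1
  · rw [setLIntegral_congr_fun hs (g := fun _ => 1) (by rintro x rfl; exact hx₀)]
    simp
  · rw [setLIntegral_congr_fun hs.compl (g := fun _ => c) (fun x hx => hc x hx)]
    simp

/-- With `p = P(X = 0)` and a weight prior giving mass `1/2` to every half-space through the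
origin, `Δ(0, 0) = p(1 − p)/4`; in particular `Δ(0, 0) ≥ 0`, with equality iff `p = 0` or
`p = 1`. -/
theorem delta_zero_zero_eq
    {Ω : Type*} [MeasureSpace Ω] [IsProbabilityMeasure (ℙ : Measure Ω)]
    {n : ℕ} (μ : Measure (EuclideanSpace ℝ (Fin n))) [IsProbabilityMeasure μ]
    (hhalf : ∀ x : EuclideanSpace ℝ (Fin n), x ≠ 0 → μ {w | 0 ≤ ⟪w, x⟫} = 1 / 2)
    (W W' X : Ω → EuclideanSpace ℝ (Fin n))
    (hWmeas : Measurable W) (hW'meas : Measurable W') (hXmeas : Measurable X)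
    (hindep : IndepFun W W' ℙ)
    (hindepX : IndepFun (fun ω => (W ω, W' ω)) X ℙ)
    (hWlaw : Measure.map W ℙ = μ) (hW'law : Measure.map W' ℙ = μ) :
    (ℙ {ω | 0 ≤ ⟪W ω, X ω⟫ ∧ 0 ≤ ⟪W' ω, X ω⟫}).toReal -
          (ℙ {ω | 0 ≤ ⟪W ω, X ω⟫}).toReal * (ℙ {ω | 0 ≤ ⟪W' ω, X ω⟫}).toReal =
        (ℙ {ω | X ω = 0}).toReal * (1 - (ℙ {ω | X ω = 0}).toReal) / 4 ∧
      (0 : ℝ) ≤ (ℙ {ω | 0 ≤ ⟪W ω, X ω⟫ ∧ 0 ≤ ⟪W' ω, X ω⟫}).toReal -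
          (ℙ {ω | 0 ≤ ⟪W ω, X ω⟫}).toReal * (ℙ {ω | 0 ≤ ⟪W' ω, X ω⟫}).toReal ∧
      ((ℙ {ω | 0 ≤ ⟪W ω, X ω⟫ ∧ 0 ≤ ⟪W' ω, X ω⟫}).toReal -
            (ℙ {ω | 0 ≤ ⟪W ω, X ω⟫}).toReal * (ℙ {ω | 0 ≤ ⟪W' ω, X ω⟫}).toReal = 0 ↔
        (ℙ {ω | X ω = 0}).toReal = 0 ∨ (ℙ {ω | X ω = 0}).toReal = 1) := by
  have hm : MeasurableSet {q : EuclideanSpace ℝ (Fin n) × EuclideanSpace ℝ (Fin n) |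
      0 ≤ ⟪q.1, q.2⟫} :=
    measurableSet_le measurable_const (measurable_fst.inner measurable_snd)
  have single : ∀ V : Ω → EuclideanSpace ℝ (Fin n), Measurable V → IndepFun V X ℙ →
      Measure.map V ℙ = μ → ℙ {ω | 0 ≤ ⟪V ω, X ω⟫} =
        ℙ {ω | X ω = 0} + 1 / 2 * (1 - ℙ {ω | X ω = 0}) := fun V hV hVX hlaw =>
    hVX.measure_eq_add_mul_of_sections hV hXmeas hm 0 (1 / 2) (by simp [hlaw])
      (fun x hx => by rw [hlaw]; exact hhalf x hx)
  have hW := single W hWmeas (hindepX.comp measurable_fst measurable_id) hWlaw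
  have hW' := single W' hW'meas (hindepX.comp measurable_snd measurable_id) hW'law
  have hpair : Measure.map (fun ω => (W ω, W' ω)) ℙ = μ.prod μ := by
    rw [(indepFun_iff_map_prod_eq_prod_map_map hWmeas.aemeasurable hW'meas.aemeasurable).1 hindep,
      hWlaw, hW'law]
  have hboth : ℙ {ω | 0 ≤ ⟪W ω, X ω⟫ ∧ 0 ≤ ⟪W' ω, X ω⟫} =
      ℙ {ω | X ω = 0} + 1 / 2 * (1 / 2) * (1 - ℙ {ω | X ω = 0}) := by
    refine hindepX.measure_eq_add_mul_of_sections (hWmeas.prodMk hW'meas) hXmeas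
      (A := {q | 0 ≤ ⟪q.1.1, q.2⟫ ∧ 0 ≤ ⟪q.1.2, q.2⟫}) ?_ 0 (1 / 2 * (1 / 2)) ?_ ?_
    · exact (hm.preimage ((measurable_fst.comp measurable_fst).prodMk measurable_snd)).inter
        (hm.preimage ((measurable_snd.comp measurable_fst).prodMk measurable_snd))
    · simp [hpair]
    · intro x hx
      rw [hpair, ← hhalf x hx, ← Measure.prod_prod]
      rfl
  have hp1 : ℙ {ω | X ω = 0} ≤ 1 := prob_le_one
  have toReal_mix : ∀ c : ENNReal, c ≠ ⊤ →
      (ℙ {ω | X ω = 0} + c * (1 - ℙ {ω | X ω = 0})).toReal =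
        (ℙ {ω | X ω = 0}).toReal + c.toReal * (1 - (ℙ {ω | X ω = 0}).toReal) := by
    intro c hc
    rw [ENNReal.toReal_add (measure_ne_top _ _) (ENNReal.mul_ne_top hc (by simp)),
      ENNReal.toReal_mul, ENNReal.toReal_sub_of_le hp1 ENNReal.one_ne_top, ENNReal.toReal_one]
  have hp1' : (ℙ {ω | X ω = 0}).toReal ≤ 1 := ENNReal.toReal_mono ENNReal.one_ne_top hp1
  have hp0 : 0 ≤ (ℙ {ω | X ω = 0}).toReal := ENNReal.toReal_nonneg
  have half_ne_top : (1 / 2 : ENNReal) ≠ ⊤ := by simp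
  have key : (ℙ {ω | 0 ≤ ⟪W ω, X ω⟫ ∧ 0 ≤ ⟪W' ω, X ω⟫}).toReal -
      (ℙ {ω | 0 ≤ ⟪W ω, X ω⟫}).toReal * (ℙ {ω | 0 ≤ ⟪W' ω, X ω⟫}).toReal =
        (ℙ {ω | X ω = 0}).toReal * (1 - (ℙ {ω | X ω = 0}).toReal) / 4 := by
    rw [hboth, hW, hW', toReal_mix _ (ENNReal.mul_ne_top half_ne_top half_ne_top),
      toReal_mix _ half_ne_top, ENNReal.toReal_mul, ENNReal.toReal_div, ENNReal.toReal_one,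
      ENNReal.toReal_ofNat]
    ring
  rw [key]
  refine ⟨rfl, div_nonneg (mul_nonneg hp0 (sub_nonneg.2 hp1')) (by norm_num), ?_⟩
  rw [div_eq_zero_iff, or_iff_left (by norm_num), mul_eq_zero, sub_eq_zero, eq_comm (a := (1 : ℝ))]
end

section
/- Let W, W̃, X : Ω → ℝⁿ be mutually independent random vectors with W and W̃ both of law μ, where μ satisfies μ({w : ⟨w, x⟩ ≥ 0}) = 1/2 for every x ≠ 0 (as holds for a centered elliptical prior with a density). Then for every z > 0 one has Δ(0, z) ≤ 0, and for every z < 0 one has Δ(0, z) ≥ 0. (Sign of the dependence measure when exactly one threshold is zero.) -/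
open MeasureTheory ProbabilityTheory
open scoped RealInnerProductSpace

/-- If `W, W', X` are independent and the law of `W` gives mass `1/2` to every half-space through
the origin, then on events depending on `(W', X)` and avoiding `X = 0`, the event `0 ≤ ⟪W, X⟫`
contributes a factor `1/2`. -/
theorem measure_nonneg_inner_and_mem_eq_half
    {Ω E : Type*} {mΩ : MeasurableSpace Ω} {P : Measure Ω} [IsProbabilityMeasure P]
    [NormedAddCommGroup E] [InnerProductSpace ℝ E] [MeasurableSpace E] [BorelSpace E]
    [SecondCountableTopology E]
    {W W' X : Ω → E}
    (hhalf : ∀ x : E, x ≠ 0 → (P.map W) {w | 0 ≤ ⟪w, x⟫} = 1 / 2)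
    (hW : Measurable W) (hW' : Measurable W') (hX : Measurable X)
    (hindep : IndepFun W W' P) (hindepX : IndepFun (fun ω => (W ω, W' ω)) X P)
    {U : Set (E × E)} (hU : MeasurableSet U) (hU0 : ∀ p ∈ U, p.2 ≠ 0) :
    P {ω | 0 ≤ ⟪W ω, X ω⟫ ∧ (W' ω, X ω) ∈ U} = 1 / 2 * P {ω | (W' ω, X ω) ∈ U} := by
  have : IsProbabilityMeasure (P.map W) := Measure.isProbabilityMeasure_map hW.aemeasurable
  have : IsProbabilityMeasure (P.map W') := Measure.isProbabilityMeasure_map hW'.aemeasurable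
  have : IsProbabilityMeasure (P.map X) := Measure.isProbabilityMeasure_map hX.aemeasurable
  have hjoint : P.map (fun ω => ((W ω, W' ω), X ω)) =
      ((P.map W).prod (P.map W')).prod (P.map X) := by
    rw [(indepFun_iff_map_prod_eq_prod_map_map (hW.prodMk hW').aemeasurable hX.aemeasurable).1
      hindepX, (indepFun_iff_map_prod_eq_prod_map_map hW.aemeasurable hW'.aemeasurable).1 hindep]
  have hpair : P.map (fun ω => (W' ω, X ω)) = (P.map W').prod (P.map X) :=
    (indepFun_iff_map_prod_eq_prod_map_map hW'.aemeasurable hX.aemeasurable).1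
      (hindepX.comp measurable_snd measurable_id)
  have hS : MeasurableSet {p : (E × E) × E | 0 ≤ ⟪p.1.1, p.2⟫ ∧ (p.1.2, p.2) ∈ U} :=
    (measurableSet_le (f := fun _ => (0 : ℝ)) (g := fun p : (E × E) × E => ⟪p.1.1, p.2⟫)
      measurable_const (by fun_prop)).inter
      ((by fun_prop : Measurable fun p : (E × E) × E => (p.1.2, p.2)) hU)
  have h1 := Measure.map_apply (μ := P) ((hW.prodMk hW').prodMk hX) hS
  have h2 := Measure.map_apply (μ := P) (hW'.prodMk hX) hU
  rw [hjoint, Measure.prod_apply_symm hS] at h1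
  rw [hpair, Measure.prod_apply_symm hU] at h2
  change _ = P {ω | 0 ≤ ⟪W ω, X ω⟫ ∧ (W' ω, X ω) ∈ U} at h1
  change _ = P {ω | (W' ω, X ω) ∈ U} at h2
  rw [← h1, ← h2, ← lintegral_const_mul _ (measurable_measure_prodMk_right hU)]
  refine lintegral_congr fun x => ?_
  have hprod : (fun p : E × E => (p, x)) ⁻¹' {p | 0 ≤ ⟪p.1.1, p.2⟫ ∧ (p.1.2, p.2) ∈ U} =
      {w | 0 ≤ ⟪w, x⟫} ×ˢ ((fun w => (w, x)) ⁻¹' U) := rfl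
  rw [hprod, Measure.prod_prod]
  by_cases hx : x = 0
  · have hempty : (fun w => (w, x)) ⁻¹' U = ∅ :=
      Set.eq_empty_of_forall_notMem fun w hw => hU0 _ hw hx
    rw [hempty]
    simp
  · rw [hhalf x hx]

/-- Sign of the dependence measure when exactly one threshold is zero: for a weight prior
giving mass `1/2` to every half-space through the origin, `Δ(0, z) ≤ 0` for `z > 0` and
`Δ(0, z) ≥ 0` for `z < 0`. -/
theorem delta_zero_z_sign
    {Ω : Type*} [MeasureSpace Ω] [IsProbabilityMeasure (ℙ : Measure Ω)]
    {n : ℕ} (μ : Measure (EuclideanSpace ℝ (Fin n))) [IsProbabilityMeasure μ]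
    (hhalf : ∀ x : EuclideanSpace ℝ (Fin n), x ≠ 0 → μ {w | 0 ≤ ⟪w, x⟫} = 1 / 2)
    (W W' X : Ω → EuclideanSpace ℝ (Fin n))
    (hWmeas : Measurable W) (hW'meas : Measurable W') (hXmeas : Measurable X)
    (hindep : IndepFun W W' ℙ)
    (hindepX : IndepFun (fun ω => (W ω, W' ω)) X ℙ)
    (hWlaw : Measure.map W ℙ = μ) (hW'law : Measure.map W' ℙ = μ)
    (z : ℝ) :
    (0 < z →
        (ℙ {ω | 0 ≤ ⟪W ω, X ω⟫ ∧ z ≤ ⟪W' ω, X ω⟫}).toReal -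
          (ℙ {ω | 0 ≤ ⟪W ω, X ω⟫}).toReal * (ℙ {ω | z ≤ ⟪W' ω, X ω⟫}).toReal ≤ 0) ∧
      (z < 0 →
        0 ≤ (ℙ {ω | 0 ≤ ⟪W ω, X ω⟫ ∧ z ≤ ⟪W' ω, X ω⟫}).toReal -
          (ℙ {ω | 0 ≤ ⟪W ω, X ω⟫}).toReal * (ℙ {ω | z ≤ ⟪W' ω, X ω⟫}).toReal) := by
  subst hWlaw
  have key := fun {U : Set (EuclideanSpace ℝ (Fin n) × EuclideanSpace ℝ (Fin n))} =>
    measure_nonneg_inner_and_mem_eq_half (U := U) hhalf hWmeas hW'meas hXmeas hindep hindepX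
  have hX0 : MeasurableSet {ω | X ω = 0} := hXmeas (measurableSet_singleton 0)
  have hsplit : ∀ s : Set Ω, (ℙ s).toReal =
      (ℙ (s ∩ {ω | X ω = 0})).toReal + (ℙ (s \ {ω | X ω = 0})).toReal := fun s =>
    (measureReal_inter_add_sdiff (μ := ℙ) (s := s) hX0).symm
  have hne : MeasurableSet
      {p : EuclideanSpace ℝ (Fin n) × EuclideanSpace ℝ (Fin n) | p.2 ≠ 0} :=
    (measurable_snd (measurableSet_singleton 0)).compl
  have hA : (ℙ ({ω | 0 ≤ ⟪W ω, X ω⟫} \ {ω | X ω = 0})).toReal =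
      1 / 2 * (ℙ (Set.univ \ {ω | X ω = 0})).toReal := by
    have h := congrArg ENNReal.toReal (key hne fun _ h => h)
    rw [ENNReal.toReal_mul] at h
    simpa [Set.sdiff_eq, Set.inter_def, Set.compl_def] using h
  have hAB : (ℙ ({ω | 0 ≤ ⟪W ω, X ω⟫ ∧ z ≤ ⟪W' ω, X ω⟫} \ {ω | X ω = 0})).toReal =
      1 / 2 * (ℙ ({ω | z ≤ ⟪W' ω, X ω⟫} \ {ω | X ω = 0})).toReal := by
    have hU : MeasurableSet
        {p : EuclideanSpace ℝ (Fin n) × EuclideanSpace ℝ (Fin n) | z ≤ ⟪p.1, p.2⟫ ∧ p.2 ≠ 0} :=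
      (measurableSet_le (f := fun _ => z)
        (g := fun p : EuclideanSpace ℝ (Fin n) × EuclideanSpace ℝ (Fin n) => ⟪p.1, p.2⟫)
        measurable_const (by fun_prop)).inter hne
    have h := congrArg ENNReal.toReal (key hU fun _ h => h.2)
    rw [ENNReal.toReal_mul] at h
    simpa [Set.sdiff_eq, Set.inter_def, and_assoc] using h
  have hA0 : {ω | 0 ≤ ⟪W ω, X ω⟫} ∩ {ω | X ω = 0} = {ω | X ω = 0} :=
    Set.inter_eq_right.2 fun ω (h : X ω = 0) => by simp [h]
  have huniv := hsplit Set.univ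
  rw [Set.univ_inter, measure_univ, ENNReal.toReal_one] at huniv
  have hsA := hsplit {ω | 0 ≤ ⟪W ω, X ω⟫}
  have hsB := hsplit {ω | z ≤ ⟪W' ω, X ω⟫}
  have hsAB := hsplit {ω | 0 ≤ ⟪W ω, X ω⟫ ∧ z ≤ ⟪W' ω, X ω⟫}
  rw [hA0, hA] at hsA
  rw [hAB] at hsAB
  have hp : 0 ≤ (ℙ {ω | X ω = 0}).toReal := ENNReal.toReal_nonneg
  have hb : 0 ≤ (ℙ {ω | z ≤ ⟪W' ω, X ω⟫}).toReal := ENNReal.toReal_nonneg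
  have hb1 : (ℙ {ω | z ≤ ⟪W' ω, X ω⟫}).toReal ≤ 1 := measureReal_le_one
  constructor
  · intro hz
    have hB0 : {ω | z ≤ ⟪W' ω, X ω⟫} ∩ {ω | X ω = 0} = ∅ := by
      refine Set.eq_empty_of_forall_notMem fun ω ⟨hω, (h : X ω = 0)⟩ => hz.not_ge ?_
      simpa [h] using hω
    have hAB0 : {ω | 0 ≤ ⟪W ω, X ω⟫ ∧ z ≤ ⟪W' ω, X ω⟫} ∩ {ω | X ω = 0} = ∅ :=
      Set.subset_empty_iff.1 fun ω h => hB0.subset ⟨h.1.2, h.2⟩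
    rw [hB0, measure_empty, ENNReal.toReal_zero] at hsB
    rw [hAB0, measure_empty, ENNReal.toReal_zero] at hsAB
    nlinarith [mul_nonneg hp hb]
  · intro hz
    have hB0 : {ω | z ≤ ⟪W' ω, X ω⟫} ∩ {ω | X ω = 0} = {ω | X ω = 0} :=
      Set.inter_eq_right.2 fun ω (h : X ω = 0) => by simp [h, hz.le]
    have hAB0 : {ω | 0 ≤ ⟪W ω, X ω⟫ ∧ z ≤ ⟪W' ω, X ω⟫} ∩ {ω | X ω = 0} = {ω | X ω = 0} :=
      Set.inter_eq_right.2 fun ω (h : X ω = 0) => by simp [h, hz.le]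
    rw [hB0] at hsB
    rw [hAB0] at hsAB
    nlinarith [mul_nonneg hp (sub_nonneg.2 hb1)]
end

section
/- Let W, W̃, X : Ω → ℝⁿ be mutually independent random vectors with W and W̃ both of law μ, where μ satisfies μ({w : ⟨w, x⟩ ≥ 0}) = 1/2 for every x ≠ 0 (as holds for a centered elliptical prior with a density), and assume P(X ≠ 0) > 0 (the previous layer's output is not identically zero, as no activation function is identically zero). Then Δ(0, z) = 0 for every z ∈ ℝ if and only if P(X = 0) = 0, i.e. if and only if the previous layer's (post-)activations vanish with probability zero. -/
open MeasureTheory ProbabilityTheory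
open scoped RealInnerProductSpace

/-- If `W` has law `μ`, giving mass `1/2` to every half-space through the origin, and is independent
of `Y`, then on an event `{Y ∈ B}` where `f Y ≠ 0` the sign of `⟪W, f Y⟫` is a fair coin. -/
theorem measure_nonneg_inner_and_mem
    {Ω E F : Type*} [MeasurableSpace Ω] {P : Measure Ω} [IsProbabilityMeasure P]
    [NormedAddCommGroup E] [InnerProductSpace ℝ E] [MeasurableSpace E] [OpensMeasurableSpace E]
    [SecondCountableTopology E] [MeasurableSpace F] {μ : Measure E}
    (hhalf : ∀ x : E, x ≠ 0 → μ {w | 0 ≤ ⟪w, x⟫} = 1 / 2)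
    {W : Ω → E} {Y : Ω → F} (hW : Measurable W) (hY : Measurable Y)
    (hindep : IndepFun W Y P) (hlaw : P.map W = μ)
    {f : F → E} (hf : Measurable f) {B : Set F} (hB : MeasurableSet B)
    (hfB : ∀ y ∈ B, f y ≠ 0) :
    P {ω | 0 ≤ ⟪W ω, f (Y ω)⟫ ∧ Y ω ∈ B} = 1 / 2 * P {ω | Y ω ∈ B} := by
  have : IsProbabilityMeasure μ := hlaw ▸ Measure.isProbabilityMeasure_map hW.aemeasurable
  have : IsProbabilityMeasure (P.map Y) := Measure.isProbabilityMeasure_map hY.aemeasurable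
  have hS : MeasurableSet {p : E × F | 0 ≤ ⟪p.1, f p.2⟫ ∧ p.2 ∈ B} := by
    rw [Set.ofPred_and]
    exact (measurableSet_le measurable_const (measurable_fst.inner (hf.comp measurable_snd))).inter
      (measurable_snd hB)
  have hprod := (indepFun_iff_map_prod_eq_prod_map_map hW.aemeasurable hY.aemeasurable).1 hindep
  rw [hlaw] at hprod
  calc P {ω | 0 ≤ ⟪W ω, f (Y ω)⟫ ∧ Y ω ∈ B}
      = (μ.prod (P.map Y)) {p : E × F | 0 ≤ ⟪p.1, f p.2⟫ ∧ p.2 ∈ B} := by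
        rw [← hprod, Measure.map_apply (hW.prodMk hY) hS]
        rfl
    _ = ∫⁻ y, B.indicator (fun _ => 1 / 2) y ∂(P.map Y) := by
        rw [Measure.prod_apply_symm hS]
        refine lintegral_congr fun y => ?_
        by_cases hy : y ∈ B
        · simpa [hy] using hhalf (f y) (hfB y hy)
        · simp [hy]
    _ = 1 / 2 * P {ω | Y ω ∈ B} := by
        rw [lintegral_indicator_const hB, Measure.map_apply hY hB]
        rfl

theorem IndepFun.prodMk_right_of_prodMk_left
    {Ω α β γ : Type*} [MeasurableSpace Ω] {P : Measure Ω} [IsProbabilityMeasure P]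
    [MeasurableSpace α] [MeasurableSpace β] [MeasurableSpace γ]
    {U : Ω → α} {V : Ω → β} {X : Ω → γ}
    (hU : Measurable U) (hV : Measurable V) (hX : Measurable X)
    (hUV : IndepFun U V P) (hUVX : IndepFun (fun ω => (U ω, V ω)) X P) :
    IndepFun U (fun ω => (V ω, X ω)) P := by
  have := Measure.isProbabilityMeasure_map (μ := P) hU.aemeasurable
  have := Measure.isProbabilityMeasure_map (μ := P) hV.aemeasurable
  have := Measure.isProbabilityMeasure_map (μ := P) hX.aemeasurable
  have hVX : IndepFun V X P := hUVX.comp measurable_snd measurable_id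
  rw [indepFun_iff_map_prod_eq_prod_map_map hU.aemeasurable (hV.prodMk hX).aemeasurable,
    (indepFun_iff_map_prod_eq_prod_map_map hV.aemeasurable hX.aemeasurable).1 hVX,
    ← (measurePreserving_prodAssoc (P.map U) (P.map V) (P.map X)).map_eq,
    ← (indepFun_iff_map_prod_eq_prod_map_map hU.aemeasurable hV.aemeasurable).1 hUV,
    ← (indepFun_iff_map_prod_eq_prod_map_map (hU.prodMk hV).aemeasurable hX.aemeasurable).1 hUVX,
    Measure.map_map MeasurableEquiv.prodAssoc.measurable ((hU.prodMk hV).prodMk hX)]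
  rfl

/-- For a weight prior giving mass `1/2` to every half-space through the origin, and a
previous-layer output `X` that is not almost surely zero, the dependence measure satisfies
`Δ(0, z) = 0` for every `z` iff the previous-layer (post-)activations vanish with
probability zero, i.e. `P(X = 0) = 0`. -/
theorem delta_zero_vanishes_iff_no_mass_at_zero
    {Ω : Type*} [MeasureSpace Ω] [IsProbabilityMeasure (ℙ : Measure Ω)]
    {n : ℕ} (μ : Measure (EuclideanSpace ℝ (Fin n))) [IsProbabilityMeasure μ]
    (hhalf : ∀ x : EuclideanSpace ℝ (Fin n), x ≠ 0 → μ {w | 0 ≤ ⟪w, x⟫} = 1 / 2)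
    (W W' X : Ω → EuclideanSpace ℝ (Fin n))
    (hWmeas : Measurable W) (hW'meas : Measurable W') (hXmeas : Measurable X)
    (hindep : IndepFun W W' ℙ)
    (hindepX : IndepFun (fun ω => (W ω, W' ω)) X ℙ)
    (hWlaw : Measure.map W ℙ = μ) (hW'law : Measure.map W' ℙ = μ)
    (hXnonzero : 0 < ℙ {ω | X ω ≠ 0}) :
    (∀ z : ℝ,
        (ℙ {ω | 0 ≤ ⟪W ω, X ω⟫ ∧ z ≤ ⟪W' ω, X ω⟫}).toReal -
          (ℙ {ω | 0 ≤ ⟪W ω, X ω⟫}).toReal * (ℙ {ω | z ≤ ⟪W' ω, X ω⟫}).toReal = 0) ↔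
      ℙ {ω | X ω = 0} = 0 := by
  have hWY := IndepFun.prodMk_right_of_prodMk_left hWmeas hW'meas hXmeas hindep hindepX
  have hW'X : IndepFun W' X ℙ := hindepX.comp measurable_snd measurable_id
  have hWX : IndepFun W X ℙ := hindepX.comp measurable_fst measurable_id
  have hne : MeasurableSet {x : EuclideanSpace ℝ (Fin n) | x ≠ 0} :=
    (measurableSet_singleton 0).compl
  have hX0 : MeasurableSet {ω | X ω ≠ 0} := hXmeas hne
  have hsplit : ∀ s : Set Ω, (ℙ : Measure Ω).real s =
      (ℙ : Measure Ω).real (s ∩ {ω | X ω ≠ 0}) + (ℙ : Measure Ω).real (s \ {ω | X ω ≠ 0}) :=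
    fun s => (measureReal_inter_add_sdiff hX0).symm
  have hg : (ℙ : Measure Ω).real ({ω | 0 ≤ ⟪W ω, X ω⟫} ∩ {ω | X ω ≠ 0}) =
      1 / 2 * (ℙ : Measure Ω).real {ω | X ω ≠ 0} := by
    have h := measure_nonneg_inner_and_mem hhalf hWmeas hXmeas hWX hWlaw measurable_id hne
      fun _ h => h
    simpa [Measure.real, ← Set.ofPred_and] using congrArg ENNReal.toReal h
  have hg' : (ℙ : Measure Ω).real ({ω | 0 ≤ ⟪W' ω, X ω⟫} ∩ {ω | X ω ≠ 0}) =
      1 / 2 * (ℙ : Measure Ω).real {ω | X ω ≠ 0} := by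
    have h := measure_nonneg_inner_and_mem hhalf hW'meas hXmeas hW'X hW'law measurable_id hne
      fun _ h => h
    simpa [Measure.real, ← Set.ofPred_and] using congrArg ENNReal.toReal h
  have hjoint : ∀ z : ℝ,
      (ℙ : Measure Ω).real ({ω | 0 ≤ ⟪W ω, X ω⟫ ∧ z ≤ ⟪W' ω, X ω⟫} ∩ {ω | X ω ≠ 0}) =
        1 / 2 * (ℙ : Measure Ω).real ({ω | z ≤ ⟪W' ω, X ω⟫} ∩ {ω | X ω ≠ 0}) := by
    intro z
    have hB : MeasurableSet {p : EuclideanSpace ℝ (Fin n) × EuclideanSpace ℝ (Fin n) |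
        z ≤ ⟪p.1, p.2⟫ ∧ p.2 ≠ 0} := by
      rw [Set.ofPred_and]
      exact (measurableSet_le measurable_const (measurable_fst.inner measurable_snd)).inter
        (measurable_snd hne)
    have h := measure_nonneg_inner_and_mem hhalf hWmeas (hW'meas.prodMk hXmeas) hWY hWlaw
      measurable_snd hB fun _ h => h.2
    simpa [Measure.real, ← Set.ofPred_and, and_assoc] using congrArg ENNReal.toReal h
  have hcompl : (ℙ : Measure Ω).real {ω | X ω ≠ 0} + (ℙ : Measure Ω).real {ω | X ω = 0} = 1 := by
    have h := measureReal_add_measureReal_compl (μ := (ℙ : Measure Ω)) hX0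
    simpa [Set.compl_ofPred] using h
  have hpos : 0 < (ℙ : Measure Ω).real {ω | X ω ≠ 0} :=
    ENNReal.toReal_pos hXnonzero.ne' (measure_ne_top _ _)
  simp only [← measureReal_def]
  rw [← measureReal_eq_zero_iff]
  constructor
  · intro h
    have hdiff : ∀ s : Set Ω, {ω | X ω = 0} ⊆ s → s \ {ω | X ω ≠ 0} = {ω | X ω = 0} := by
      intro s hs
      ext ω
      simpa using fun hω => hs hω
    have h0 := h 0
    rw [hsplit {ω | 0 ≤ ⟪W ω, X ω⟫ ∧ 0 ≤ ⟪W' ω, X ω⟫}, hsplit {ω | 0 ≤ ⟪W ω, X ω⟫},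
      hsplit {ω | 0 ≤ ⟪W' ω, X ω⟫}, hjoint, hg, hg',
      hdiff _ fun ω (hω : X ω = 0) => by simp [hω],
      hdiff _ fun ω (hω : X ω = 0) => by simp [hω],
      hdiff _ fun ω (hω : X ω = 0) => by simp [hω]] at h0
    have hmul : (ℙ : Measure Ω).real {ω | X ω ≠ 0} * (ℙ : Measure Ω).real {ω | X ω = 0} = 0 := by
      rw [← eq_sub_iff_add_eq] at hcompl
      rw [hcompl] at h0 ⊢
      linarith
    exact (mul_eq_zero.1 hmul).resolve_left hpos.ne'
  · intro h z
    have hdiff : ∀ s : Set Ω, (ℙ : Measure Ω).real (s \ {ω | X ω ≠ 0}) = 0 := fun s =>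
      measureReal_mono_null (fun ω hω => not_not.1 hω.2) h
    rw [h, add_zero] at hcompl
    rw [hsplit {ω | 0 ≤ ⟪W ω, X ω⟫ ∧ z ≤ ⟪W' ω, X ω⟫}, hsplit {ω | 0 ≤ ⟪W ω, X ω⟫},
      hsplit {ω | z ≤ ⟪W' ω, X ω⟫}, hjoint, hg, hdiff, hdiff, hdiff, hcompl]
    ring
end
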